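/- For a finite joint probability distribution p with full-support marginal p_A, defining T = Σ_b √(Σ_a p(a,b)²/p(a)) (so that T = 2^{I_2(A;B)/2} where I_2 is the Rényi mutual information of order 2 according to Sibson), one has T − 1 ≤ V_2(A;B) ≤ T, where V_2(A;B) = Σ_b p(b)√(Σ_a p(a|b)²/p(a) − 1). -/

import Mathlib

open Finset

/-- With `T = Σ_b √(Σ_a p(a,b)²/p(a)) = 2^{I_2(A;B)/2}` one has
`T − 1 ≤ V_2(A;B) ≤ T`, where `V_2(A;B) = Σ_b p(b)√(Σ_a p(a|b)²/p(a) − 1)`. -/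
theorem stmt_4 {A B : Type*} [Fintype A] [Fintype B]
    (p : A → B → ℝ) (hp : ∀ a b, 0 ≤ p a b)
    (hsum : ∑ a, ∑ b, p a b = 1)
    (hfull : ∀ a, 0 < ∑ b, p a b) :
    (∑ b, Real.sqrt (∑ a, (p a b) ^ 2 / (∑ b', p a b'))) - 1 ≤
      (∑ b, (∑ a', p a' b) * Real.sqrt
        ((∑ a, (p a b / (∑ a', p a' b)) ^ 2 / (∑ b', p a b')) - 1)) ∧
    (∑ b, (∑ a', p a' b) * Real.sqrt
        ((∑ a, (p a b / (∑ a', p a' b)) ^ 2 / (∑ b', p a b')) - 1)) ≤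
      ∑ b, Real.sqrt (∑ a, (p a b) ^ 2 / (∑ b', p a b')) := by
  have key : ∀ b, Real.sqrt (∑ a, (p a b) ^ 2 / (∑ b', p a b')) =
      (∑ a', p a' b) * Real.sqrt (∑ a, (p a b / (∑ a', p a' b)) ^ 2 / (∑ b', p a b')) := by
    intro b
    have h0 : 0 ≤ ∑ a', p a' b := Finset.sum_nonneg fun a _ => hp a b
    rcases h0.eq_or_lt with h | h
    · have hz : ∀ a, p a b = 0 := fun a =>
        (Finset.sum_eq_zero_iff_of_nonneg (fun a _ => hp a b)).1 h.symm a (Finset.mem_univ a)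
      simp [hz]
    · have e : ∑ a, (p a b) ^ 2 / (∑ b', p a b') =
          (∑ a', p a' b) ^ 2 * ∑ a, (p a b / (∑ a', p a' b)) ^ 2 / (∑ b', p a b') := by
        rw [Finset.mul_sum]
        refine Finset.sum_congr rfl fun a _ => ?_
        have h1 := (hfull a).ne'
        have h2 := h.ne'
        rw [div_pow, ← mul_div_assoc, mul_div_cancel₀ _ (pow_ne_zero 2 h2)]
      rw [e, Real.sqrt_mul (sq_nonneg _), Real.sqrt_sq h0]
  have hB : ∑ b, ∑ a', p a' b = 1 := by rw [Finset.sum_comm]; exact hsum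
  have hs : ∀ x : ℝ, Real.sqrt x ≤ Real.sqrt (x - 1) + 1 := by
    intro x
    have h0 := Real.sqrt_nonneg (x - 1)
    rw [Real.sqrt_le_left (by linarith)]
    rcases le_total 1 x with h | h
    · nlinarith [Real.sq_sqrt (sub_nonneg.2 h)]
    · nlinarith
  constructor
  · rw [sub_le_iff_le_add, ← hB, ← Finset.sum_add_distrib]
    refine Finset.sum_le_sum fun b _ => ?_
    rw [key b]
    have h0 : 0 ≤ ∑ a', p a' b := Finset.sum_nonneg fun a _ => hp a b
    refine (mul_le_mul_of_nonneg_left (hs _) h0).trans ?_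
    rw [mul_add, mul_one, hB]
  · refine Finset.sum_le_sum fun b _ => ?_
    rw [key b]
    have h0 : 0 ≤ ∑ a', p a' b := Finset.sum_nonneg fun a _ => hp a b
    exact mul_le_mul_of_nonneg_left (Real.sqrt_le_sqrt (by linarith)) h0
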